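/- arXiv:2009.11430 — 3 statements merged into one kernel-verified Lean document; each statement's English description precedes it below -/
import Mathlib

section
/- For every integer k ≥ 1 and every completely monotone function ψ : ℕ^k → ℝ, there exists a finite Borel measure μ on the cube [0,1]^k whose moment function equals ψ, i.e. ψ(n) = ∫_{[0,1]^k} x₁^{n₁}⋯x_k^{n_k} μ(dx) for all n ∈ ℕ^k. (Hard direction of the multidimensional Hausdorff moment problem, Lemma 3.1 (ii)⇒(iii).) -/
open MeasureTheory Finset

lemma hm_prod_sub {ι : Type*} (s : Finset ι) (a b : ι → ℝ)
    (ha : ∀ i ∈ s, 0 ≤ a i ∧ a i ≤ 1) (hb : ∀ i ∈ s, 0 ≤ b i ∧ b i ≤ 1) :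
    |∏ i ∈ s, a i - ∏ i ∈ s, b i| ≤ ∑ i ∈ s, |a i - b i| := by
  classical
  induction s using Finset.induction_on with
  | empty => simp
  | insert i s hi ih =>
    rw [prod_insert hi, prod_insert hi, sum_insert hi]
    have ih' := ih (fun j hj => ha j (mem_insert_of_mem hj)) (fun j hj => hb j (mem_insert_of_mem hj))
    have h1 := ha i (mem_insert_self _ _)
    have h2 : 0 ≤ ∏ j ∈ s, b j := prod_nonneg fun j hj => (hb j (mem_insert_of_mem hj)).1
    have h3 : ∏ j ∈ s, b j ≤ 1 := prod_le_one (fun j hj => (hb j (mem_insert_of_mem hj)).1)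
      (fun j hj => (hb j (mem_insert_of_mem hj)).2)
    have : a i * ∏ j ∈ s, a j - b i * ∏ j ∈ s, b j
      = a i * (∏ j ∈ s, a j - ∏ j ∈ s, b j) + (a i - b i) * ∏ j ∈ s, b j := by ring
    rw [this]
    refine (abs_add_le _ _).trans ?_
    rw [abs_mul, abs_mul, abs_of_nonneg h1.1, abs_of_nonneg h2]
    nlinarith [abs_nonneg (a i - b i), abs_nonneg (∏ j ∈ s, a j - ∏ j ∈ s, b j)]

lemma hm_factor (N j l : ℕ) (hj : j ≤ N) (hl : l < N) :
    |(j : ℝ) / N - ((j - l : ℕ) : ℝ) / ((N - l : ℕ) : ℝ)| ≤ l / N := by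
  have hN : (0 : ℝ) < N := by exact_mod_cast (by omega : 0 < N)
  rcases le_or_gt l j with h | h
  · have hNl : (0 : ℝ) < N - l := by
      have : (l : ℝ) < N := by exact_mod_cast hl
      linarith
    have hj' : (j : ℝ) ≤ N := by exact_mod_cast hj
    have h' : (l : ℝ) ≤ j := by exact_mod_cast h
    rw [Nat.cast_sub h, Nat.cast_sub hl.le]
    have : (j : ℝ) / N - (j - l) / (N - l) = l / N * ((N - j) / (N - l)) := by
      field_simp
      ring
    rw [this, abs_of_nonneg (by
      apply mul_nonneg (by positivity)
      apply div_nonneg <;> linarith)]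
    apply mul_le_of_le_one_right (by positivity)
    rw [div_le_one hNl]; linarith
  · rw [Nat.sub_eq_zero_of_le h.le]
    simp only [Nat.cast_zero, zero_div, sub_zero]
    rw [abs_of_nonneg (by positivity)]
    gcongr

/-- ratio -/
noncomputable def hmR (N j n : ℕ) : ℝ := (j.descFactorial n : ℝ) / (N.descFactorial n : ℝ)

lemma hmR_eq (N j n : ℕ) : hmR N j n = ∏ l ∈ range n, ((j - l : ℕ) : ℝ) / ((N - l : ℕ) : ℝ) := by
  rw [hmR, Nat.descFactorial_eq_prod_range, Nat.descFactorial_eq_prod_range]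
  push_cast
  rw [prod_div_distrib]

lemma hm_ratio (N j l : ℕ) (hj : j ≤ N) : 0 ≤ ((j - l : ℕ) : ℝ) / ((N - l : ℕ) : ℝ) ∧
    ((j - l : ℕ) : ℝ) / ((N - l : ℕ) : ℝ) ≤ 1 := by
  refine ⟨by positivity, ?_⟩
  apply div_le_one_of_le₀ _ (by positivity)
  exact_mod_cast Nat.sub_le_sub_right hj l

lemma hmR_mem (N j n : ℕ) (hj : j ≤ N) : 0 ≤ hmR N j n ∧ hmR N j n ≤ 1 := by
  rw [hmR_eq]
  exact ⟨prod_nonneg fun l _ => (hm_ratio N j l hj).1,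
    prod_le_one (fun l _ => (hm_ratio N j l hj).1) (fun l _ => (hm_ratio N j l hj).2)⟩

lemma hmR_approx (N j n : ℕ) (hj : j ≤ N) (hn : n ≤ N) :
    |((j : ℝ) / N) ^ n - hmR N j n| ≤ (n * n : ℝ) / N := by
  rw [hmR_eq]
  have : ((j : ℝ) / N) ^ n = ∏ l ∈ range n, (j : ℝ) / N := by rw [prod_const, card_range]
  rw [this]
  refine (hm_prod_sub _ _ _ (fun l _ => by simpa using hm_ratio N j 0 hj)
    (fun l _ => hm_ratio N j l hj)).trans ?_
  have : ∑ l ∈ range n, |(j : ℝ) / N - ((j - l : ℕ) : ℝ) / ((N - l : ℕ) : ℝ)| 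
      ≤ ∑ l ∈ range n, (n : ℝ) / N := by
    apply sum_le_sum
    intro l hl
    rw [mem_range] at hl
    refine (hm_factor N j l hj (by omega)).trans ?_
    gcongr
  refine this.trans ?_
  simp [mul_div_assoc]

lemma hm_multi {k : ℕ} (N : ℕ) (n j : Fin k → ℕ) (hj : ∀ i, j i ≤ N) (hn : ∀ i, n i ≤ N) :
    |∏ i, ((j i : ℝ) / N) ^ n i - ∏ i, hmR N (j i) (n i)| ≤ (∑ i, (n i * n i : ℝ)) / N := by
  refine (hm_prod_sub _ _ _ (fun i _ => ?_) (fun i _ => hmR_mem _ _ _ (hj i))).trans ?_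
  · have := hm_ratio N (j i) 0 (hj i)
    simp only [Nat.sub_zero] at this
    exact ⟨pow_nonneg this.1 _, pow_le_one₀ this.1 this.2⟩
  · rw [sum_div]
    exact sum_le_sum fun i _ => hmR_approx _ _ _ (hj i) (hn i)

/-- functional -/
noncomputable def hmL {k : ℕ} (ψ : (Fin k → ℕ) → ℝ) : MvPolynomial (Fin k) ℝ →ₗ[ℝ] ℝ :=
  (MvPolynomial.basisMonomials (Fin k) ℝ).constr ℝ (fun s => ψ s)

lemma hmL_prod {k : ℕ} (ψ : (Fin k → ℕ) → ℝ) (n : Fin k → ℕ) :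
    hmL ψ (∏ i, MvPolynomial.X i ^ n i) = ψ n := by
  have h : (∏ i, (MvPolynomial.X i : MvPolynomial (Fin k) ℝ) ^ n i)
      = MvPolynomial.basisMonomials (Fin k) ℝ (Finsupp.equivFunOnFinite.symm n) := by
    rw [MvPolynomial.coe_basisMonomials]
    beta_reduce
    rw [MvPolynomial.monomial_eq, Finsupp.prod_fintype _ _ (by simp)]
    simp
  rw [h, hmL, Module.Basis.constr_basis]
  rfl

lemma hm_iic {k : ℕ} (n : Fin k → ℕ) : Fintype.piFinset (fun i => range (n i + 1)) = Iic n := by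
  ext p
  simp [Fintype.mem_piFinset, Pi.le_def]

lemma hmL_bern {k : ℕ} (ψ : (Fin k → ℕ) → ℝ) (n m : Fin k → ℕ) :
    hmL ψ (∏ i, (MvPolynomial.X i ^ m i * (1 - MvPolynomial.X i) ^ n i)) =
    ∑ p ∈ Finset.Iic n,
        (-1 : ℝ) ^ (∑ i, p i) * (∏ i, ((n i).choose (p i) : ℝ)) * ψ (m + p) := by
  have h1 : ∀ i, (MvPolynomial.X i ^ m i * (1 - MvPolynomial.X i) ^ n i : MvPolynomial (Fin k) ℝ)
      = ∑ p ∈ range (n i + 1), 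
        (MvPolynomial.C ((-1) ^ p * ((n i).choose p : ℝ)) * MvPolynomial.X i ^ (m i + p)) := by
    intro i
    rw [sub_eq_neg_add, add_pow, mul_sum]
    refine sum_congr rfl fun p _ => ?_
    rw [neg_pow]
    simp
    ring
  rw [prod_congr rfl fun i _ => h1 i, prod_univ_sum, map_sum, hm_iic]
  refine sum_congr rfl fun p _ => ?_
  rw [prod_mul_distrib, ← map_prod, ← MvPolynomial.smul_eq_C_mul, map_smul, prod_mul_distrib,
    prod_pow_eq_pow_sum, smul_eq_mul]
  congr 1
  exact hmL_prod ψ (m + p)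

/-- weights -/
noncomputable def hmW {k : ℕ} (ψ : (Fin k → ℕ) → ℝ) (N : ℕ) (j : Fin k → ℕ) : ℝ :=
  hmL ψ (∏ i, (MvPolynomial.C (N.choose (j i) : ℝ) *
    (MvPolynomial.X i ^ j i * (1 - MvPolynomial.X i) ^ (N - j i))))

lemma hmW_nonneg {k : ℕ} (ψ : (Fin k → ℕ) → ℝ) 
    (hcm : ∀ n m : Fin k → ℕ,
      0 ≤ ∑ p ∈ Finset.Iic n,
        (-1 : ℝ) ^ (∑ i, p i) * (∏ i, ((n i).choose (p i) : ℝ)) * ψ (m + p))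
    (N : ℕ) (j : Fin k → ℕ) : 0 ≤ hmW ψ N j := by
  rw [hmW, prod_mul_distrib, ← map_prod, ← MvPolynomial.smul_eq_C_mul, map_smul, smul_eq_mul]
  refine mul_nonneg (prod_nonneg fun i _ => by positivity) ?_
  rw [hmL_bern ψ (fun i => N - j i) j]
  exact hcm _ _

lemma hm_one {R : Type*} [CommRing R] [Algebra ℝ R] (x : R) (N n : ℕ) (hn : n ≤ N) :
    ∑ j ∈ range (N + 1), algebraMap ℝ R (hmR N j n) * 
      (algebraMap ℝ R (N.choose j : ℝ) * (x ^ j * (1 - x) ^ (N - j))) = x ^ n := by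
  obtain ⟨M, rfl⟩ := Nat.exists_eq_add_of_le hn
  rw [add_assoc, sum_range_add]
  rw [sum_eq_zero, zero_add]
  · have : x ^ n = x ^ n * (x + (1 - x)) ^ M := by simp
    rw [this, add_pow, mul_sum]
    refine sum_congr rfl fun q hq => ?_
    rw [mem_range] at hq
    have h : hmR (n + M) (n + q) n * ((n + M).choose (n + q) : ℝ) = (M.choose q : ℝ) := by
      have h0 : ((n + M).descFactorial n : ℝ) ≠ 0 := by
        have := Nat.pos_of_ne_zero (mt Nat.descFactorial_eq_zero_iff_lt.1 (by omega : ¬ n + M < n))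
        positivity
      rw [hmR, div_mul_eq_mul_div, div_eq_iff h0]
      rw [Nat.descFactorial_eq_factorial_mul_choose, Nat.descFactorial_eq_factorial_mul_choose]
      have := Nat.choose_mul (n := n + M) (k := n + q) (s := n) (by omega) 
      simp only [Nat.add_sub_cancel_left] at this
      have h3 : ((n + M).choose (n + q) : ℝ) * ((n + q).choose n) = (n + M).choose n * M.choose q := by
        exact_mod_cast this
      push_cast
      linear_combination (n.factorial : ℝ) * h3
    rw [← mul_assoc, ← map_mul, h]
    rw [show n + M - (n + q) = M - q by omega, pow_add]
    simp
    ring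
  · intro j hj
    rw [mem_range] at hj
    simp [hmR, Nat.descFactorial_eq_zero_iff_lt.2 hj]

lemma hmW_sum {k : ℕ} (ψ : (Fin k → ℕ) → ℝ) (N : ℕ) (n : Fin k → ℕ) (hn : ∀ i, n i ≤ N) :
    ∑ j ∈ Fintype.piFinset (fun _ : Fin k => range (N + 1)), hmW ψ N j * ∏ i, hmR N (j i) (n i)
      = ψ n := by
  rw [← hmL_prod ψ n]
  rw [prod_congr rfl fun i _ => (hm_one (MvPolynomial.X i : MvPolynomial (Fin k) ℝ) N (n i) (hn i)).symm]
  rw [prod_univ_sum, map_sum]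
  refine sum_congr rfl fun j _ => ?_
  rw [prod_mul_distrib, ← map_prod, MvPolynomial.algebraMap_eq, ← MvPolynomial.smul_eq_C_mul, map_smul,
    smul_eq_mul, mul_comm]
  rfl

lemma hmW_tot {k : ℕ} (ψ : (Fin k → ℕ) → ℝ) (N : ℕ) :
    ∑ j ∈ Fintype.piFinset (fun _ : Fin k => range (N + 1)), hmW ψ N j = ψ 0 := by
  rw [← hmW_sum ψ N 0 (by simp)]
  simp [hmR]

lemma hm_measure {k : ℕ} (ψ : (Fin k → ℕ) → ℝ)
    (hcm : ∀ n m : Fin k → ℕ,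
      0 ≤ ∑ p ∈ Finset.Iic n,
        (-1 : ℝ) ^ (∑ i, p i) * (∏ i, ((n i).choose (p i) : ℝ)) * ψ (m + p)) (N : ℕ) :
    ∃ μ : FiniteMeasure (Fin k → ℝ), μ.mass ≤ (ψ 0).toNNReal ∧ μ (Set.Icc 0 1)ᶜ = 0 ∧
      ∀ n : Fin k → ℕ, (∀ i, n i ≤ N) → 
        |∫ x, ∏ i, (x i) ^ (n i) ∂(μ : Measure (Fin k → ℝ)) - ψ n|
          ≤ ψ 0 * ((∑ i, (n i * n i : ℝ)) / N) := by
  set S := Fintype.piFinset (fun _ : Fin k => range (N + 1)) with hS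
  have hSm : ∀ j ∈ S, ∀ i, j i ≤ N := by
    intro j hj i
    have := Fintype.mem_piFinset.1 hj i
    rw [mem_range] at this
    omega
  have hw := hmW_nonneg ψ hcm N
  let ν : Measure (Fin k → ℝ) := ∑ j ∈ S, ENNReal.ofReal (hmW ψ N j) •
    Measure.dirac (fun i => (j i : ℝ) / N)
  have hfin : ∀ j ∈ S, IsFiniteMeasure (ENNReal.ofReal (hmW ψ N j) •
    Measure.dirac (fun i => (j i : ℝ) / N : Fin k → ℝ)) := fun j _ => 
      Measure.smul_finite _ ENNReal.ofReal_ne_top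
  have hmass : ν Set.univ = ENNReal.ofReal (ψ 0) := by
    simp only [ν, Measure.coe_finsetSum, Finset.sum_apply, Measure.smul_apply, measure_univ,
      smul_eq_mul, mul_one]
    rw [← ENNReal.ofReal_sum_of_nonneg fun j _ => hw j, hmW_tot]
  have hνf : IsFiniteMeasure ν := ⟨by rw [hmass]; exact ENNReal.ofReal_lt_top⟩
  obtain ⟨ρ, hρ⟩ : ∃ ρ : FiniteMeasure (Fin k → ℝ), (ρ : Measure (Fin k → ℝ)) = ν := ⟨⟨ν, hνf⟩, rfl⟩
  refine ⟨ρ, ?_, ?_, ?_⟩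
  · rw [← ENNReal.coe_le_coe, FiniteMeasure.ennreal_mass, hρ]
    exact hmass.le
  · rw [← ENNReal.coe_eq_zero, FiniteMeasure.ennreal_coeFn_eq_coeFn_toMeasure]
    rw [hρ]
    simp only [ν, Measure.coe_finsetSum, Finset.sum_apply, Measure.smul_apply, smul_eq_mul]
    refine sum_eq_zero fun j hj => ?_
    rw [Measure.dirac_apply' _ measurableSet_Icc.compl, Set.indicator_of_notMem, mul_zero]
    rw [Set.notMem_compl_iff]
    have h := fun i => hm_ratio N (j i) 0 (hSm j hj i)
    simp only [Nat.sub_zero] at h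
    exact ⟨fun i => (h i).1, fun i => (h i).2⟩
  · intro n hn
    have hint : ∫ x, ∏ i, (x i) ^ (n i) ∂ν = ∑ j ∈ S, hmW ψ N j * ∏ i, ((j i : ℝ) / N) ^ n i := by
      simp only [ν]
      rw [integral_finsetSum_measure]
      · refine sum_congr rfl fun j hj => ?_
        rw [integral_smul_measure, integral_dirac, ENNReal.toReal_ofReal (hw j), smul_eq_mul]
      · intro j hj
        refine Integrable.smul_measure ?_ ENNReal.ofReal_ne_top
        exact integrable_dirac (by simp)
    rw [hρ]
    rw [hint, ← hmW_sum ψ N n hn, ← hS, ← sum_sub_distrib, ← hmW_tot ψ N, ← hS, sum_mul]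
    refine (abs_sum_le_sum_abs _ _).trans (sum_le_sum fun j hj => ?_)
    rw [← mul_sub, abs_mul, abs_of_nonneg (hw j)]
    exact mul_le_mul_of_nonneg_left (hm_multi N n j (hSm j hj) hn) (hw j)

theorem hausdorff_moment_problem_existence
    (k : ℕ) (hk : 1 ≤ k) (ψ : (Fin k → ℕ) → ℝ)
    (hcm : ∀ n m : Fin k → ℕ,
      0 ≤ ∑ p ∈ Finset.Iic n,
        (-1 : ℝ) ^ (∑ i, p i) * (∏ i, ((n i).choose (p i) : ℝ)) * ψ (m + p)) :
    ∃ μ : Measure (Fin k → ℝ), IsFiniteMeasure μ ∧ μ (Set.Icc 0 1)ᶜ = 0 ∧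
      ∀ n : Fin k → ℕ, ψ n = ∫ x, ∏ i, (x i) ^ (n i) ∂μ := by
  choose μ hmass hsupp hmom using hm_measure ψ hcm
  have hK : IsCompact (Set.Icc (0 : Fin k → ℝ) 1) := isCompact_Icc
  have hC := isCompact_setOfPred_finiteMeasure_le_of_isCompact (ψ 0).toNNReal hK
  obtain ⟨ν, hν, hle⟩ := hC.ultrafilter_le_nhds ((Filter.hyperfilter ℕ).map μ) (by
    rw [Filter.le_principal_iff, Ultrafilter.coe_map, Filter.mem_map]
    exact Filter.univ_mem' fun N => ⟨hmass N, hsupp N⟩)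
  have hT : Filter.Tendsto μ (Filter.hyperfilter ℕ) (nhds ν) := hle
  have hν0 : (ν : Measure (Fin k → ℝ)) (Set.Icc 0 1)ᶜ = 0 := by
    rw [← FiniteMeasure.ennreal_coeFn_eq_coeFn_toMeasure, ENNReal.coe_eq_zero]
    exact hν.2
  refine ⟨ν, inferInstance, hν0, fun n => ?_⟩
  let c : ℝ → ℝ := fun t => max 0 (min t 1)
  have hc : ∀ t, 0 ≤ c t ∧ c t ≤ 1 := fun t => ⟨le_max_left _ _, max_le zero_le_one (min_le_right _ _)⟩
  let f : BoundedContinuousFunction (Fin k → ℝ) ℝ :=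
    BoundedContinuousFunction.ofNormedAddCommGroup (fun x => ∏ i, c (x i) ^ n i)
      (by simp only [c]; fun_prop) 1 (fun x => by
        rw [Real.norm_eq_abs, abs_of_nonneg (prod_nonneg fun i _ => pow_nonneg (hc _).1 _)]
        exact prod_le_one (fun i _ => pow_nonneg (hc _).1 _)
          (fun i _ => pow_le_one₀ (hc _).1 (hc _).2))
  have hf : ∀ ρ : Measure (Fin k → ℝ), ρ (Set.Icc 0 1)ᶜ = 0 →
      ∫ x, f x ∂ρ = ∫ x, ∏ i, (x i) ^ (n i) ∂ρ := by
    intro ρ hρ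
    refine integral_congr_ae ?_
    have : ∀ᵐ x ∂ρ, x ∈ Set.Icc (0 : Fin k → ℝ) 1 := hρ
    filter_upwards [this] with x hx
    change ∏ i, c (x i) ^ n i = _
    refine prod_congr rfl fun i _ => ?_
    have h1 : 0 ≤ x i := hx.1 i
    have h2 : x i ≤ 1 := hx.2 i
    simp [c, h1, h2]
  have hlim := (FiniteMeasure.tendsto_iff_forall_integral_tendsto.1 hT) f
  rw [hf _ hν0] at hlim
  refine tendsto_nhds_unique ?_ hlim
  have hat : Filter.Tendsto (fun N => ∫ x, f x ∂(μ N : Measure (Fin k → ℝ))) Filter.atTop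
      (nhds (ψ n)) := by
    have h0 : Filter.Tendsto (fun N : ℕ => ψ 0 * ((∑ i, (n i * n i : ℝ)) / N)) Filter.atTop
        (nhds 0) := by
      simpa using (tendsto_const_div_atTop_nhds_zero_nat (∑ i, (n i * n i : ℝ))).const_mul (ψ 0)
    rw [tendsto_iff_dist_tendsto_zero]
    refine squeeze_zero' (Filter.Eventually.of_forall fun _ => dist_nonneg) ?_ h0
    filter_upwards [Filter.eventually_ge_atTop (∑ i, n i)] with N hN
    rw [hf _ (by
      rw [← FiniteMeasure.ennreal_coeFn_eq_coeFn_toMeasure, ENNReal.coe_eq_zero]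
      exact hsupp N), Real.dist_eq]
    exact hmom N n fun i => (single_le_sum (fun _ _ => Nat.zero_le _) (mem_univ i)).trans hN
  exact hat.mono_left Nat.hyperfilter_le_atTop
end

section
/- For all real parameters θ > 0, u₁ > 0, u₂ > 0, a₂ ≥ 0 and any real α, the second-moment system (E21)–(E23) has a unique solution (M₂₀, M₁₁, M₀₂) ∈ ℝ³; equivalently, the 3×3 coefficient matrix of the system is invertible. -/
/-- The second-moment system (E21)–(E23) has a unique solution
`(M₂₀, M₁₁, M₀₂) ∈ ℝ³` for all θ > 0, u₁ > 0, u₂ > 0, a₂ ≥ 0 and any α. -/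
theorem second_moment_system_unique_solution
    (θ u₁ u₂ a₂ α : ℝ) (hθ : 0 < θ) (hu₁ : 0 < u₁) (hu₂ : 0 < u₂)
    (ha₂ : 0 ≤ a₂) :
    ∃! M : ℝ × ℝ × ℝ,
      (θ + 2 * u₂ + a₂) * M.1 - 2 * u₂ * M.2.1 = θ * α ^ 2 + a₂ * α ∧
      -2 * u₁ * M.2.1 + (θ + 2 * u₁ + a₂) * M.2.2 = θ * α ^ 2 + a₂ * α ∧
      -u₁ * M.1 + (θ + u₁ + u₂) * M.2.1 - u₂ * M.2.2 = θ * α ^ 2 := by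
  have hR : ∃ R, R = θ * α ^ 2 + a₂ * α := ⟨_, rfl⟩
  obtain ⟨R, hR⟩ := hR
  obtain ⟨S, hS⟩ : ∃ S, S = θ * α ^ 2 := ⟨_, rfl⟩
  obtain ⟨A, hA⟩ : ∃ A, A = θ + 2 * u₂ + a₂ := ⟨_, rfl⟩
  obtain ⟨B, hB⟩ : ∃ B, B = θ + 2 * u₁ + a₂ := ⟨_, rfl⟩
  obtain ⟨C, hC⟩ : ∃ C, C = θ + u₁ + u₂ := ⟨_, rfl⟩
  rw [← hR, ← hS, ← hA, ← hB, ← hC]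
  have hA0 : 0 < A := by rw [hA]; positivity
  have hB0 : 0 < B := by rw [hB]; positivity
  obtain ⟨D, hD⟩ : ∃ D, D = C * A * B - 2 * u₁ * u₂ * (A + B) := ⟨_, rfl⟩
  have hD0 : 0 < D := by
    have h : D = u₁ * B * (θ + a₂) + u₂ * A * (θ + a₂) + θ * A * B := by
      rw [hD, hC, hA, hB]; ring
    rw [h]; positivity
  obtain ⟨y, hy⟩ : ∃ y, y = (S * A * B + u₁ * R * B + u₂ * R * A) / D := ⟨_, rfl⟩
  have hy' : y * D = S * A * B + u₁ * R * B + u₂ * R * A := by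
    rw [hy]; field_simp
  refine ⟨((R + 2 * u₂ * y) / A, y, (R + 2 * u₁ * y) / B), ⟨?_, ?_, ?_⟩, ?_⟩
  · field_simp; ring
  · field_simp; ring
  · rw [hD] at hy'
    simp only
    field_simp
    linear_combination hy'
  · rintro ⟨p, q, r⟩ ⟨h1, h2, h3⟩
    simp only at h1 h2 h3
    have hq : q = y := by
      apply mul_right_cancel₀ hD0.ne'
      rw [hy', hD]
      linear_combination A * B * h3 + u₁ * B * h1 + u₂ * A * h2
    subst hq
    have hp : p = (R + 2 * u₂ * q) / A := by
      rw [eq_div_iff hA0.ne']; linear_combination h1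
    have hr : r = (R + 2 * u₁ * q) / B := by
      rw [eq_div_iff hB0.ne']; linear_combination h2
    rw [hp, hr]
end

section
/- Let θ > 0 and u > 0 be real, set α = 1/2 and u₁ = u₂ = u, and let a₂, a₂₁, a₃, a₂₁₁, a₂₂, a₃₁, a₄ be nonnegative reals satisfying the consistency relations a₂ = a₂₁ + a₃, a₃ = a₃₁ + a₄, a₂₁ = a₂₁₁ + a₂₂ + a₃₁, with a₃ > 0. Then there exist no real numbers M₂₀, M₁₁, M₀₂, M₃₀, M₂₁, M₁₂, M₀₃, M₄₀, M₃₁, M₂₂, M₁₃, M₀₄ satisfying simultaneously the second-moment system (E21)–(E23), the third-moment system (E31)–(E34), the fourth-moment system (E41)–(E45), and the two reversibility equations (F1): (θα/2)M₃₀ − (a₂ + θα/2)M₂₁ − uM₂₂ + uM₄₀ + a₂M₃₁ = 0 and (F2): (a₂ + θα/2)M₂₁ + (θα/2)M₃₀ − (θ + 2u + a₂)M₃₁ + uM₂₂ + uM₄₀ = 0. (Computational core of the irreversibility of the generalized stepping stone model with Ξ-resampling mechanism, Theorem 5.2.) -/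
set_option maxHeartbeats 4000000

theorem hom_aux (P Q k l x y : ℝ) (h1 : P * x = k * y) (h2 : Q * y = l * x)
    (h : 0 < P * Q - k * l) : x = 0 ∧ y = 0 := by
  constructor
  · have : (P * Q - k * l) * x = 0 := by linear_combination Q * h1 + k * h2
    exact (mul_eq_zero.mp this).resolve_left h.ne'
  · have : (P * Q - k * l) * y = 0 := by linear_combination P * h2 + l * h1
    exact (mul_eq_zero.mp this).resolve_left h.ne'

/-- Computational core of the irreversibility of the generalized stepping
stone model with Ξ-resampling mechanism (Theorem 5.2): with `α = 1/2`,
equal migration rates `u₁ = u₂ = u`, and consistent coalescence rates with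
`a₃ > 0`, no moments can satisfy the second-, third- and fourth-moment
systems together with the two reversibility equations (F1) and (F2). -/
theorem irreversibility_core
    (θ u a₂ a₂₁ a₃ a₂₁₁ a₂₂ a₃₁ a₄ : ℝ)
    (hθ : 0 < θ) (hu : 0 < u)
    (ha₂ : 0 ≤ a₂) (ha₂₁ : 0 ≤ a₂₁) (ha₃pos : 0 < a₃)
    (ha₂₁₁ : 0 ≤ a₂₁₁) (ha₂₂ : 0 ≤ a₂₂) (ha₃₁ : 0 ≤ a₃₁) (ha₄ : 0 ≤ a₄)
    (hc₁ : a₂ = a₂₁ + a₃) (hc₂ : a₃ = a₃₁ + a₄)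
    (hc₃ : a₂₁ = a₂₁₁ + a₂₂ + a₃₁) :
    ¬ ∃ M₂₀ M₁₁ M₀₂ M₃₀ M₂₁ M₁₂ M₀₃ M₄₀ M₃₁ M₂₂ M₁₃ M₀₄ : ℝ,
      -- second-moment system (E21)–(E23) with α = 1/2, u₁ = u₂ = u
      (θ + 2 * u + a₂) * M₂₀ - 2 * u * M₁₁
        = θ * (1 / 2) ^ 2 + a₂ * (1 / 2) ∧
      -2 * u * M₁₁ + (θ + 2 * u + a₂) * M₀₂
        = θ * (1 / 2) ^ 2 + a₂ * (1 / 2) ∧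
      -u * M₂₀ + (θ + u + u) * M₁₁ - u * M₀₂ = θ * (1 / 2) ^ 2 ∧
      -- third-moment system (E31)–(E34)
      (3 * a₂₁ + a₃ + (3 / 2) * θ + 3 * u) * M₃₀ - 3 * u * M₂₁
        = (3 * a₂₁ + (3 / 2) * (1 / 2) * θ) * M₂₀ + a₃ * (1 / 2) ∧
      -u * M₃₀ + (a₂ + (3 / 2) * θ + 2 * u + u) * M₂₁ - 2 * u * M₁₂
        = ((1 / 2) * θ + a₂) * M₁₁ + (θ * (1 / 2) / 2) * M₂₀ ∧
      -2 * u * M₂₁ + (a₂ + (3 / 2) * θ + u + 2 * u) * M₁₂ - u * M₀₃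
        = ((1 / 2) * θ + a₂) * M₁₁ + (θ * (1 / 2) / 2) * M₀₂ ∧
      -3 * u * M₁₂ + (3 * a₂₁ + a₃ + (3 / 2) * θ + 3 * u) * M₀₃
        = (3 * a₂₁ + (3 / 2) * (1 / 2) * θ) * M₀₂ + a₃ * (1 / 2) ∧
      -- fourth-moment system (E41)–(E45)
      (4 * u + 6 * a₂₁₁ + 3 * a₂₂ + 4 * a₃₁ + a₄ + 2 * θ) * M₄₀
          - 4 * u * M₃₁
        = (2 * θ * (1 / 2) + 6 * a₂₁₁) * M₃₀ + (3 * a₂₂ + 4 * a₃₁) * M₂₀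
          + a₄ * (1 / 2) ∧
      -u * M₄₀ + (a₃ + 3 * a₂₁ + 2 * θ + 3 * u + u) * M₃₁ - 3 * u * M₂₂
        = (3 * a₂₁ + (3 / 2) * θ * (1 / 2)) * M₂₁ + a₃ * M₁₁
          + (θ * (1 / 2) / 2) * M₃₀ ∧
      -2 * u * M₃₁ + (2 * a₂ + 2 * θ + 2 * u + 2 * u) * M₂₂ - 2 * u * M₁₃
        = (θ * (1 / 2) + a₂) * M₁₂ + (θ * (1 / 2) + a₂) * M₂₁ ∧
      -3 * u * M₂₂ + (2 * θ + u + 3 * u + 3 * a₂₁ + a₃) * M₁₃ - u * M₀₄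
        = (θ * (1 / 2) / 2) * M₀₃ + (3 * a₂₁ + (3 / 2) * θ * (1 / 2)) * M₁₂
          + a₃ * M₁₁ ∧
      -4 * u * M₁₃
          + (6 * a₂₁₁ + 3 * a₂₂ + 4 * a₃₁ + a₄ + 2 * θ + 4 * u) * M₀₄
        = (2 * θ * (1 / 2) + 6 * a₂₁₁) * M₀₃ + (3 * a₂₂ + 4 * a₃₁) * M₀₂
          + a₄ * (1 / 2) ∧
      -- reversibility equations (F1) and (F2)
      (θ * (1 / 2) / 2) * M₃₀ - (a₂ + θ * (1 / 2) / 2) * M₂₁ - u * M₂₂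
          + u * M₄₀ + a₂ * M₃₁ = 0 ∧
      (a₂ + θ * (1 / 2) / 2) * M₂₁ + (θ * (1 / 2) / 2) * M₃₀
          - (θ + 2 * u + a₂) * M₃₁ + u * M₂₂ + u * M₄₀ = 0 := by
  rintro ⟨M₂₀, M₁₁, M₀₂, M₃₀, M₂₁, M₁₂, M₀₃, M₄₀, M₃₁, M₂₂, M₁₃, M₀₄,
    E21, E22, E23, E31, E32, E33, E34, E41, E42, E43, E44, E45, F1, F2⟩
  have hd2 : M₀₂ = M₂₀ := by
    have h : (θ + 2 * u + a₂) * (M₀₂ - M₂₀) = 0 := by linear_combination E22 - E21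
    have := (mul_eq_zero.mp h).resolve_left (by positivity)
    linarith
  subst hd2
  obtain ⟨h1, h2⟩ := hom_aux (3 * a₂₁ + a₃ + (3 / 2) * θ + 3 * u) (a₂ + (3 / 2) * θ + 5 * u)
    (3 * u) u (M₃₀ - M₀₃) (M₂₁ - M₁₂) (by linear_combination E31 - E34)
    (by linear_combination E32 - E33) (by ring_nf; positivity)
  obtain rfl : M₃₀ = M₀₃ := by linarith
  obtain rfl : M₂₁ = M₁₂ := by linarith
  obtain ⟨h3, h4⟩ := hom_aux (3 * a₂₁ + a₃ + (3 / 2) * θ + 3 * u) (a₂ + (3 / 2) * θ + u)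
    (3 * u) u (M₃₀ - 3 / 2 * M₀₂ + 1 / 4) (M₂₁ - M₀₂ / 2 - M₁₁ + 1 / 4)
    (by subst hc₁; linear_combination E31 - 3 / 2 * E21)
    (by linear_combination E32 - 1 / 2 * E21 - E23) (by ring_nf; positivity)
  obtain ⟨h5, h6⟩ := hom_aux (4 * u + 6 * a₂₁₁ + 3 * a₂₂ + 4 * a₃₁ + a₄ + 2 * θ)
    (a₃ + 3 * a₂₁ + 2 * θ + 4 * u)
    (4 * u) u (M₄₀ - M₀₄) (M₃₁ - M₁₃) (by linear_combination E41 - E45)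
    (by linear_combination E42 - E44) (by ring_nf; positivity)
  obtain rfl : M₄₀ = M₀₄ := by linarith
  obtain rfl : M₃₁ = M₁₃ := by linarith
  obtain ⟨p, hp⟩ : ∃ p, M₀₂ = p + 1 / 4 := ⟨M₀₂ - 1 / 4, by ring⟩
  obtain ⟨q, hq⟩ : ∃ q, M₁₁ = q + 1 / 4 := ⟨M₁₁ - 1 / 4, by ring⟩
  obtain rfl : M₃₀ = 3 / 2 * p + 1 / 8 := by linarith
  obtain rfl : M₂₁ = p / 2 + q + 1 / 8 := by linarith
  obtain ⟨A, rfl⟩ : ∃ A, M₄₀ = A + 3 / 2 * p + 1 / 16 := ⟨M₄₀ - 3 / 2 * p - 1 / 16, by ring⟩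
  obtain ⟨B, rfl⟩ : ∃ B, M₃₁ = B + 3 / 4 * p + 3 / 4 * q + 1 / 16 :=
    ⟨M₃₁ - 3 / 4 * p - 3 / 4 * q - 1 / 16, by ring⟩
  obtain ⟨C, rfl⟩ : ∃ C, M₂₂ = C + p / 2 + q + 1 / 16 := ⟨M₂₂ - p / 2 - q - 1 / 16, by ring⟩
  subst hp hq
  have G1 : (θ + 2 * u + a₂) * p - 2 * u * q = a₂ / 4 := by linear_combination E21
  have G2 : (θ + 2 * u) * q - 2 * u * p = 0 := by linear_combination E23
  have H1 : (θ + 2 * u) * B - 2 * u * A = 0 := by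
    linear_combination -F1 - F2 - 3 / 4 * G2
  have H2 : (2 * a₂ + θ + 2 * u) * B - 2 * u * C - a₂ / 2 * q = 0 := by
    linear_combination F1 - F2 - 1 / 2 * G1 - 1 / 4 * G2
  have K2 : (3 * a₂₁ + a₃ + 2 * θ + 4 * u) * B - u * A - 3 * u * C
      = (3 * a₂₁ + a₃) * q / 4 := by
    subst hc₁
    linear_combination E42 - 3 / 4 * G1 - 3 / 4 * G2
  have K3 : 2 * (a₂ + θ + 2 * u) * C - 4 * u * B = a₂ * p / 2 := by
    linear_combination E43 - 1 / 2 * G1 - G2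
  have hB : B = q / 4 := by
    have h : a₃ * (B - q / 4) = 0 := by
      subst hc₁
      linear_combination -1 / 2 * K2 + 3 / 4 * H2 + 1 / 4 * H1
    have := (mul_eq_zero.mp h).resolve_left ha₃pos.ne'
    linarith
  subst hB
  have hC : C = p / 4 := by
    have h : u * (C - p / 4) = 0 := by linear_combination -1 / 2 * H2 + 1 / 8 * G2
    have := (mul_eq_zero.mp h).resolve_left hu.ne'
    linarith
  subst hC
  have hp : p = 0 := by
    have h : (θ * (θ + 4 * u)) * p = 0 := by
      linear_combination 2 * (θ + 2 * u) * K3 + 2 * u * G2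
    exact (mul_eq_zero.mp h).resolve_left (by positivity)
  subst hp
  have hq : q = 0 := by
    have h : (θ + 2 * u) * q = 0 := by linear_combination G2
    exact (mul_eq_zero.mp h).resolve_left (by positivity)
  subst hq
  linarith
end
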